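/- arXiv:1104.2116 — 6 statements merged into one kernel-verified Lean document; each statement's English description precedes it below -/
import Mathlib

section
/- Let Λ₁ > Λ₂ ≥ 0 and B > 0, and for ρ > 0 define F(ρ) := (Λ₁·h(ρΛ₁/2) − Λ₂·h(ρΛ₂/2)) / (Λ₁ − Λ₂) − h(ρB/2), where the term Λ₂·h(ρΛ₂/2) is interpreted as 0 when Λ₂ = 0. Then lim_{ρ → 0⁺} F(ρ)/ρ = (Λ₁ + Λ₂ − B)/2. -/
open Filter

/-- `h(x) = exp(1/x) · E₁(1/x)` where `E₁(y) = ∫_y^∞ e^{-t}/t dt`. -/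
noncomputable def hfun (x : ℝ) : ℝ :=
  Real.exp (1 / x) * ∫ t in Set.Ioi (1 / x), Real.exp (-t) / t

open MeasureTheory Topology

theorem integrableOn_exp_neg_div_Ioi {y : ℝ} (hy : 0 < y) :
    IntegrableOn (fun t : ℝ => Real.exp (-t) / t) (Set.Ioi y) := by
  refine Integrable.mono' ((integrableOn_exp_neg_Ioi y).const_mul y⁻¹)
    (Measurable.aestronglyMeasurable (by fun_prop)) ?_
  filter_upwards [ae_restrict_mem measurableSet_Ioi] with t ht
  have hyt : y < t := ht
  have ht0 : 0 < t := hy.trans hyt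
  rw [Real.norm_of_nonneg (by positivity), div_eq_inv_mul]
  gcongr

theorem integral_exp_neg_div_Ioi_le {y : ℝ} (hy : 0 < y) :
    ∫ t in Set.Ioi y, Real.exp (-t) / t ≤ y⁻¹ * Real.exp (-y) := by
  rw [← integral_exp_neg_Ioi y, ← integral_const_mul]
  refine setIntegral_mono_on (integrableOn_exp_neg_div_Ioi hy)
    ((integrableOn_exp_neg_Ioi y).const_mul y⁻¹) measurableSet_Ioi fun t ht => ?_
  have hyt : y < t := ht
  rw [div_eq_inv_mul]
  gcongr

theorem le_integral_exp_neg_div_Ioi {y : ℝ} (hy : 0 < y) :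
    (1 + y)⁻¹ * Real.exp (-y) ≤ ∫ t in Set.Ioi y, Real.exp (-t) / t := by
  have hderiv : ∀ t ∈ Set.Ici y, HasDerivAt (fun t : ℝ => -(Real.exp (-t) / t))
      (Real.exp (-t) * (1 / t + 1 / t ^ 2)) t := by
    intro t ht
    have ht0 : t ≠ 0 := (hy.trans_le ht).ne'
    refine (((hasDerivAt_neg' t).exp).div (hasDerivAt_id' t) ht0).neg.congr_deriv ?_
    field_simp
    ring
  have hnonneg : ∀ t ∈ Set.Ioi y, 0 ≤ Real.exp (-t) * (1 / t + 1 / t ^ 2) := by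
    intro t ht
    have ht0 : 0 < t := hy.trans ht
    positivity
  have hlim : Tendsto (fun t : ℝ => -(Real.exp (-t) / t)) atTop (𝓝 0) := by
    simpa [div_eq_mul_inv] using
      ((Real.tendsto_exp_neg_atTop_nhds_zero).mul tendsto_inv_atTop_zero).neg
  have hint := integrableOn_Ioi_deriv_of_nonneg' hderiv hnonneg hlim
  have heq := integral_Ioi_of_hasDerivAt_of_nonneg' hderiv hnonneg hlim
  have hle : ∫ t in Set.Ioi y, y / (1 + y) * (Real.exp (-t) * (1 / t + 1 / t ^ 2)) ≤
      ∫ t in Set.Ioi y, Real.exp (-t) / t := by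
    refine setIntegral_mono_on (hint.const_mul _) (integrableOn_exp_neg_div_Ioi hy)
      measurableSet_Ioi fun t ht => ?_
    have hyt : y < t := ht
    have ht0 : 0 < t := hy.trans hyt
    have hfac : y / (1 + y) * (1 / t + 1 / t ^ 2) ≤ 1 / t := by
      rw [div_add_div _ _ ht0.ne' (by positivity), div_mul_div_comm,
        div_le_div_iff₀ (by positivity) ht0]
      nlinarith [mul_pos ht0 ht0]
    calc _ = Real.exp (-t) * (y / (1 + y) * (1 / t + 1 / t ^ 2)) := by ring
      _ ≤ Real.exp (-t) * (1 / t) := by gcongr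
      _ = _ := by ring
  rw [integral_const_mul, heq] at hle
  convert hle using 1
  field_simp
  ring

theorem hfun_le {x : ℝ} (hx : 0 < x) : hfun x ≤ x := by
  have h := mul_le_mul_of_nonneg_left (integral_exp_neg_div_Ioi_le (one_div_pos.2 hx))
    (Real.exp_pos (1 / x)).le
  rwa [mul_left_comm, ← Real.exp_add, add_neg_cancel, Real.exp_zero, mul_one, one_div,
    inv_inv, ← one_div] at h

theorem div_one_add_le_hfun {x : ℝ} (hx : 0 < x) : x / (1 + x) ≤ hfun x := by
  have h := mul_le_mul_of_nonneg_left (le_integral_exp_neg_div_Ioi (one_div_pos.2 hx))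
    (Real.exp_pos (1 / x)).le
  rw [mul_left_comm, ← Real.exp_add, add_neg_cancel, Real.exp_zero, mul_one] at h
  refine le_trans (le_of_eq ?_) h
  field_simp
  ring

theorem tendsto_hfun_div_self : Tendsto (fun x => hfun x / x) (𝓝[>] 0) (𝓝 1) := by
  have hlow : Tendsto (fun x : ℝ => 1 / (1 + x)) (𝓝[>] 0) (𝓝 1) := by
    have hcont : ContinuousAt (fun x : ℝ => 1 / (1 + x)) 0 := by
      fun_prop (disch := norm_num)
    simpa using hcont.tendsto.mono_left nhdsWithin_le_nhds
  refine tendsto_of_tendsto_of_tendsto_of_le_of_le' hlow tendsto_const_nhds ?_ ?_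
  · filter_upwards [self_mem_nhdsWithin] with x hx
    have hx0 : 0 < x := hx
    rw [le_div_iff₀ hx0, one_div_mul_eq_div]
    exact div_one_add_le_hfun hx0
  · filter_upwards [self_mem_nhdsWithin] with x hx
    exact (div_le_one hx).2 (hfun_le hx)

theorem tendsto_hfun_mul_div {c : ℝ} (hc : 0 < c) :
    Tendsto (fun ρ => hfun (ρ * c / 2) / ρ) (𝓝[>] 0) (𝓝 (c / 2)) := by
  have hscale : Tendsto (fun ρ : ℝ => ρ * c / 2) (𝓝[>] 0) (𝓝[>] 0) := by
    refine tendsto_nhdsWithin_iff.2 ⟨?_, ?_⟩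
    · have hcont : Continuous (fun ρ : ℝ => ρ * c / 2) := by fun_prop
      simpa using (hcont.tendsto 0).mono_left nhdsWithin_le_nhds
    · filter_upwards [self_mem_nhdsWithin] with ρ hρ
      have hρ0 : 0 < ρ := hρ
      exact Set.mem_Ioi.2 (by positivity)
  have h := (tendsto_hfun_div_self.comp hscale).mul_const (c / 2)
  rw [one_mul] at h
  refine h.congr' ?_
  filter_upwards [self_mem_nhdsWithin] with ρ hρ
  have hρ0 : ρ ≠ 0 := ne_of_gt hρ
  simp only [Function.comp_apply]
  field_simp

theorem statement2 (Λ₁ Λ₂ B : ℝ) (h12 : Λ₁ > Λ₂) (h2 : 0 ≤ Λ₂) (hB : 0 < B) :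
    Tendsto (fun ρ : ℝ =>
        ((Λ₁ * hfun (ρ * Λ₁ / 2) - (if Λ₂ = 0 then 0 else Λ₂ * hfun (ρ * Λ₂ / 2)))
            / (Λ₁ - Λ₂) - hfun (ρ * B / 2)) / ρ)
      (nhdsWithin 0 (Set.Ioi 0)) (nhds ((Λ₁ + Λ₂ - B) / 2)) := by
  have hsecond : Tendsto (fun ρ : ℝ => (if Λ₂ = 0 then 0 else Λ₂ * hfun (ρ * Λ₂ / 2)) / ρ)
      (𝓝[>] 0) (𝓝 (Λ₂ * (Λ₂ / 2))) := by
    rcases h2.eq_or_lt with h | h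
    · simp [← h]
    · simpa [h.ne', mul_div_assoc] using (tendsto_hfun_mul_div h).const_mul Λ₂
  have hfirst := (tendsto_hfun_mul_div (h2.trans_lt h12)).const_mul Λ₁
  have hdiff : Λ₁ - Λ₂ ≠ 0 := sub_ne_zero.2 h12.ne'
  convert ((hfirst.sub hsecond).div_const (Λ₁ - Λ₂)).sub (tendsto_hfun_mul_div hB) using 2
  · ring
  · field_simp
    ring
end

section
/- Let A, B > 0 and C ≥ 0 satisfy C² < A·B and (A−B)² + 4C² > 0, and set d := 2·√(A·B − C²)/(A + B). Then 0 < d < 1 and R^∞(A, B, C) = (1/2)·g(d) + log(1 + A/B) − log 2. -/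
/-- The high-SNR rate `R^∞(A,B,C)`, with the convention that the first summand
equals `1` when `(A-B)² + 4C² = 0`. -/
noncomputable def Rinf (A B C : ℝ) : ℝ :=
  (if (A - B) ^ 2 + 4 * C ^ 2 = 0 then 1 else
    (A + B) / (2 * Real.sqrt ((A - B) ^ 2 + 4 * C ^ 2)) *
      Real.log ((A + B + Real.sqrt ((A - B) ^ 2 + 4 * C ^ 2)) /
        (A + B - Real.sqrt ((A - B) ^ 2 + 4 * C ^ 2))))
  + 1 / 2 * Real.log ((A * B - C ^ 2) / B ^ 2)

/-- `f(z) = (1/√(1-z²)) · log((1+√(1-z²))/(1-√(1-z²)))` for `0 < z < 1`. -/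
noncomputable def ffun (z : ℝ) : ℝ :=
  1 / Real.sqrt (1 - z ^ 2) *
    Real.log ((1 + Real.sqrt (1 - z ^ 2)) / (1 - Real.sqrt (1 - z ^ 2)))

/-- `g(z) = f(z) + 2·log z`. -/
noncomputable def gfun (z : ℝ) : ℝ := ffun z + 2 * Real.log z

theorem statement8 (A B C : ℝ) (hA : 0 < A) (hB : 0 < B) (hC : 0 ≤ C)
    (h1 : C ^ 2 < A * B) (h2 : (A - B) ^ 2 + 4 * C ^ 2 > 0)
    (d : ℝ) (hd : d = 2 * Real.sqrt (A * B - C ^ 2) / (A + B)) :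
    (0 < d ∧ d < 1) ∧
      Rinf A B C = 1 / 2 * gfun d + Real.log (1 + A / B) - Real.log 2 := by
  have hAB : 0 < A + B := add_pos hA hB
  have hD : 0 < A * B - C ^ 2 := sub_pos.2 h1
  have hdpos : 0 < d := by rw [hd]; positivity
  have hdsq : d ^ 2 = 4 * (A * B - C ^ 2) / (A + B) ^ 2 := by
    rw [hd, div_pow, mul_pow, Real.sq_sqrt hD.le]
    norm_num
  have hcompl : 1 - d ^ 2 = ((A - B) ^ 2 + 4 * C ^ 2) / (A + B) ^ 2 := by
    rw [hdsq]
    field_simp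
    ring
  have hdlt : d < 1 := by
    have : 0 < 1 - d ^ 2 := by rw [hcompl]; positivity
    nlinarith
  refine ⟨⟨hdpos, hdlt⟩, ?_⟩
  have hsqrt : √(1 - d ^ 2) = √((A - B) ^ 2 + 4 * C ^ 2) / (A + B) := by
    rw [hcompl, Real.sqrt_div' _ (sq_nonneg _), Real.sqrt_sq hAB.le]
  have hlogd : Real.log d =
      Real.log 2 + Real.log (A * B - C ^ 2) / 2 - Real.log (A + B) := by
    rw [hd, Real.log_div (by positivity) hAB.ne',
      Real.log_mul two_ne_zero (by positivity), Real.log_sqrt hD.le]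
  have hlogAB : Real.log (1 + A / B) = Real.log (A + B) - Real.log B := by
    rw [← Real.log_div hAB.ne' hB.ne', add_div, div_self hB.ne', add_comm]
  have hlogD : Real.log ((A * B - C ^ 2) / B ^ 2) =
      Real.log (A * B - C ^ 2) - 2 * Real.log B := by
    rw [Real.log_div hD.ne' (by positivity), Real.log_pow]
    norm_num
  have hquot (s : ℝ) :
      (1 + s / (A + B)) / (1 - s / (A + B)) = (A + B + s) / (A + B - s) := by
    rw [one_add_div hAB.ne', one_sub_div hAB.ne', div_div_div_cancel_right₀ hAB.ne']
  rw [Rinf, if_neg h2.ne', gfun, ffun, hsqrt, hquot, hlogd, hlogAB, hlogD, one_div_div]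
  ring
end

section
/- The function f is strictly decreasing on (0,1) and the function g is strictly increasing on (0,1); moreover for all z ∈ (0,1), 2 < f(z) and 2·log 2 < g(z) < 2; and f(z) → 2 and g(z) → 2 as z → 1⁻, while f(z) → ∞ and g(z) → 2·log 2 as z → 0⁺. -/
open Filter

open Set Topology

/-- The derivative of `s ↦ log (1 + s) - log (1 - s)` is `2 / (1 - s ^ 2)`. -/
lemma hasDerivAt_log_one_add_sub_log_one_sub {s : ℝ} (h : s ∈ Ioo (-1 : ℝ) 1) :
    HasDerivAt (fun s : ℝ => Real.log (1 + s) - Real.log (1 - s)) (2 / (1 - s ^ 2)) s := by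
  have h1 : 1 + s ≠ 0 := by linarith [h.1]
  have h2 : 1 - s ≠ 0 := by linarith [h.2]
  have h3 : 1 - s ^ 2 ≠ 0 := by
    rw [show 1 - s ^ 2 = (1 + s) * (1 - s) by ring]
    exact mul_ne_zero h1 h2
  refine ((((hasDerivAt_id s).const_add 1).log h1).sub
    (((hasDerivAt_id s).const_sub 1).log h2)).congr_deriv ?_
  simp only [id]
  rw [eq_div_iff h3]
  field_simp
  ring

lemma two_mul_lt_log_one_add_sub_log_one_sub {s : ℝ} (h : s ∈ Ioo (0 : ℝ) 1) :
    2 * s < Real.log (1 + s) - Real.log (1 - s) := by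
  have hd : ∀ x ∈ Ico (0 : ℝ) 1, HasDerivAt
      (fun s : ℝ => Real.log (1 + s) - Real.log (1 - s) - 2 * s)
      (2 / (1 - x ^ 2) - 2 * 1) x := fun x hx =>
    (hasDerivAt_log_one_add_sub_log_one_sub ⟨by linarith [hx.1], hx.2⟩).sub
      ((hasDerivAt_id x).const_mul 2)
  have hm : StrictMonoOn (fun s : ℝ => Real.log (1 + s) - Real.log (1 - s) - 2 * s)
      (Ico 0 1) := by
    refine strictMonoOn_of_deriv_pos (convex_Ico 0 1)
      (fun x hx => (hd x hx).continuousAt.continuousWithinAt) fun x hx => ?_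
    rw [interior_Ico] at hx
    rw [(hd x ⟨hx.1.le, hx.2⟩).deriv]
    have hx2 : 0 < 1 - x ^ 2 := by nlinarith [hx.1, hx.2]
    have : 2 < 2 / (1 - x ^ 2) := by
      rw [lt_div_iff₀ hx2]
      nlinarith [hx.1]
    linarith
  have := hm ⟨le_rfl, one_pos⟩ ⟨h.1.le, h.2⟩ h.1
  simp at this
  linarith

lemma log_one_add_sub_log_one_sub_lt {s : ℝ} (h : s ∈ Ioo (0 : ℝ) 1) :
    Real.log (1 + s) - Real.log (1 - s) < 2 * s / (1 - s ^ 2) := by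
  have hd : ∀ x ∈ Ico (0 : ℝ) 1, HasDerivAt
      (fun s : ℝ => 2 * s / (1 - s ^ 2) - (Real.log (1 + s) - Real.log (1 - s)))
      (4 * x ^ 2 / (1 - x ^ 2) ^ 2) x := fun x hx => by
    have hx2 : 1 - x ^ 2 ≠ 0 := by nlinarith [hx.1, hx.2]
    refine ((((hasDerivAt_id x).const_mul 2).div ((hasDerivAt_pow 2 x).const_sub 1) hx2).sub
      (hasDerivAt_log_one_add_sub_log_one_sub ⟨by linarith [hx.1], hx.2⟩)).congr_deriv ?_
    simp only [id]
    field_simp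
    push_cast
    ring
  have hm : StrictMonoOn
      (fun s : ℝ => 2 * s / (1 - s ^ 2) - (Real.log (1 + s) - Real.log (1 - s)))
      (Ico 0 1) := by
    refine strictMonoOn_of_deriv_pos (convex_Ico 0 1)
      (fun x hx => (hd x hx).continuousAt.continuousWithinAt) fun x hx => ?_
    rw [interior_Ico] at hx
    rw [(hd x ⟨hx.1.le, hx.2⟩).deriv]
    have hx2 : 0 < 1 - x ^ 2 := by nlinarith [hx.1, hx.2]
    have := hx.1
    positivity
  have := hm ⟨le_rfl, one_pos⟩ ⟨h.1.le, h.2⟩ h.1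
  simp at this
  linarith

lemma hasDerivAt_log_one_add_sub_log_one_sub_div {s : ℝ} (h : s ∈ Ioo (0 : ℝ) 1) :
    HasDerivAt (fun s : ℝ => (Real.log (1 + s) - Real.log (1 - s)) / s)
      ((2 * s / (1 - s ^ 2) - (Real.log (1 + s) - Real.log (1 - s))) / s ^ 2) s := by
  refine ((hasDerivAt_log_one_add_sub_log_one_sub ⟨by linarith [h.1], h.2⟩).div
    (hasDerivAt_id s) h.1.ne').congr_deriv ?_
  simp only [id]
  ring

lemma strictMonoOn_log_one_add_sub_log_one_sub_div :
    StrictMonoOn (fun s : ℝ => (Real.log (1 + s) - Real.log (1 - s)) / s) (Ioo 0 1) := by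
  refine strictMonoOn_of_deriv_pos (convex_Ioo 0 1) (fun x hx =>
    (hasDerivAt_log_one_add_sub_log_one_sub_div hx).continuousAt.continuousWithinAt)
    fun x hx => ?_
  rw [interior_Ioo] at hx
  rw [(hasDerivAt_log_one_add_sub_log_one_sub_div hx).deriv]
  exact div_pos (sub_pos.2 (log_one_add_sub_log_one_sub_lt hx)) (pow_pos hx.1 2)

lemma strictAntiOn_log_one_add_sub_log_one_sub_div_add_log :
    StrictAntiOn (fun s : ℝ => (Real.log (1 + s) - Real.log (1 - s)) / s + Real.log (1 - s ^ 2))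
      (Ioo 0 1) := by
  have hd : ∀ x ∈ Ioo (0 : ℝ) 1, HasDerivAt
      (fun s : ℝ => (Real.log (1 + s) - Real.log (1 - s)) / s + Real.log (1 - s ^ 2))
      ((2 * x - (Real.log (1 + x) - Real.log (1 - x))) / x ^ 2) x := fun x hx => by
    have hx2 : 1 - x ^ 2 ≠ 0 := by nlinarith [hx.1, hx.2]
    have hx0 := hx.1.ne'
    refine ((hasDerivAt_log_one_add_sub_log_one_sub_div hx).add
      (((hasDerivAt_pow 2 x).const_sub 1).log hx2)).congr_deriv ?_
    field_simp
    push_cast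
    ring
  refine strictAntiOn_of_deriv_neg (convex_Ioo 0 1) (fun x hx =>
    (hd x hx).continuousAt.continuousWithinAt) fun x hx => ?_
  rw [interior_Ioo] at hx
  rw [(hd x hx).deriv]
  exact div_neg_of_neg_of_pos (sub_neg.2 (two_mul_lt_log_one_add_sub_log_one_sub hx))
    (pow_pos hx.1 2)

lemma sqrt_one_sub_sq_mem_Ioo {z : ℝ} (hz : z ∈ Ioo (0 : ℝ) 1) :
    √(1 - z ^ 2) ∈ Ioo (0 : ℝ) 1 := by
  refine ⟨Real.sqrt_pos.2 (by nlinarith [hz.1, hz.2]), ?_⟩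
  rw [Real.sqrt_lt' one_pos]
  nlinarith [hz.1]

lemma one_sub_sq_sqrt_one_sub_sq {z : ℝ} (hz : z ∈ Ioo (0 : ℝ) 1) :
    1 - √(1 - z ^ 2) ^ 2 = z ^ 2 := by
  rw [Real.sq_sqrt (by nlinarith [hz.1, hz.2])]
  ring

lemma strictAntiOn_sqrt_one_sub_sq : StrictAntiOn (fun z : ℝ => √(1 - z ^ 2)) (Ioo 0 1) :=
  fun x hx y hy hxy => Real.sqrt_lt_sqrt (by nlinarith [hy.1, hy.2])
    (by nlinarith [hx.1, hy.1])

lemma ffun_eq {z : ℝ} (hz : z ∈ Ioo (0 : ℝ) 1) :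
    ffun z = (Real.log (1 + √(1 - z ^ 2)) - Real.log (1 - √(1 - z ^ 2))) / √(1 - z ^ 2) := by
  obtain ⟨h0, h1⟩ := sqrt_one_sub_sq_mem_Ioo hz
  rw [ffun, Real.log_div (by linarith) (by linarith), one_div_mul_eq_div]

lemma gfun_eq {z : ℝ} (hz : z ∈ Ioo (0 : ℝ) 1) :
    gfun z = (Real.log (1 + √(1 - z ^ 2)) - Real.log (1 - √(1 - z ^ 2))) / √(1 - z ^ 2)
      + Real.log (1 - √(1 - z ^ 2) ^ 2) := by
  rw [gfun, ffun_eq hz, one_sub_sq_sqrt_one_sub_sq hz, Real.log_pow]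
  norm_num

/-- `gfun` written through `x ↦ x * log x`, which extends continuously to `z = 0`. -/
lemma gfun_eq_mul_log {z : ℝ} (hz : z ∈ Ioo (0 : ℝ) 1) :
    gfun z = ((1 + √(1 - z ^ 2)) * Real.log (1 + √(1 - z ^ 2))
      - (1 - √(1 - z ^ 2)) * Real.log (1 - √(1 - z ^ 2))) / √(1 - z ^ 2) := by
  rw [gfun_eq hz]
  obtain ⟨h0, h1⟩ := sqrt_one_sub_sq_mem_Ioo hz
  generalize √(1 - z ^ 2) = s at h0 h1
  rw [show 1 - s ^ 2 = (1 + s) * (1 - s) by ring, Real.log_mul (by linarith) (by linarith)]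
  field_simp
  ring

lemma strictAntiOn_ffun : StrictAntiOn ffun (Ioo 0 1) := fun x hx y hy hxy => by
  rw [ffun_eq hx, ffun_eq hy]
  exact strictMonoOn_log_one_add_sub_log_one_sub_div (sqrt_one_sub_sq_mem_Ioo hy)
    (sqrt_one_sub_sq_mem_Ioo hx) (strictAntiOn_sqrt_one_sub_sq hx hy hxy)

lemma strictMonoOn_gfun : StrictMonoOn gfun (Ioo 0 1) := fun x hx y hy hxy => by
  rw [gfun_eq hx, gfun_eq hy]
  exact strictAntiOn_log_one_add_sub_log_one_sub_div_add_log (sqrt_one_sub_sq_mem_Ioo hy)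
    (sqrt_one_sub_sq_mem_Ioo hx) (strictAntiOn_sqrt_one_sub_sq hx hy hxy)

lemma two_lt_ffun {z : ℝ} (hz : z ∈ Ioo (0 : ℝ) 1) : 2 < ffun z := by
  have hs := sqrt_one_sub_sq_mem_Ioo hz
  rw [ffun_eq hz, lt_div_iff₀ hs.1]
  exact two_mul_lt_log_one_add_sub_log_one_sub hs

lemma ffun_lt_two_div_sq {z : ℝ} (hz : z ∈ Ioo (0 : ℝ) 1) : ffun z < 2 / z ^ 2 := by
  have hs := sqrt_one_sub_sq_mem_Ioo hz
  rw [ffun_eq hz, div_lt_iff₀ hs.1]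
  have := log_one_add_sub_log_one_sub_lt hs
  rwa [one_sub_sq_sqrt_one_sub_sq hz, mul_div_right_comm] at this

lemma tendsto_ffun_one : Tendsto ffun (𝓝[Ioo 0 1] 1) (𝓝 2) := by
  have h : Tendsto (fun z : ℝ => 2 / z ^ 2) (𝓝[Ioo 0 1] 1) (𝓝 2) := by
    have : ContinuousAt (fun z : ℝ => 2 / z ^ 2) 1 := by
      fun_prop (disch := norm_num)
    simpa [ContinuousAt] using this.tendsto.mono_left nhdsWithin_le_nhds
  refine tendsto_of_tendsto_of_tendsto_of_le_of_le' tendsto_const_nhds h ?_ ?_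
  · filter_upwards [self_mem_nhdsWithin] with z hz using (two_lt_ffun hz).le
  · filter_upwards [self_mem_nhdsWithin] with z hz using (ffun_lt_two_div_sq hz).le

lemma tendsto_gfun_one : Tendsto gfun (𝓝[Ioo 0 1] 1) (𝓝 2) := by
  have h : Tendsto (fun z : ℝ => 2 * Real.log z) (𝓝[Ioo 0 1] 1) (𝓝 0) := by
    have : ContinuousAt (fun z : ℝ => 2 * Real.log z) 1 := by
      fun_prop (disch := norm_num)
    simpa using this.tendsto.mono_left nhdsWithin_le_nhds
  rw [← add_zero (2 : ℝ)]
  exact tendsto_ffun_one.add h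

lemma tendsto_gfun_zero : Tendsto gfun (𝓝[Ioo 0 1] 0) (𝓝 (2 * Real.log 2)) := by
  have hc : ContinuousAt (fun s : ℝ => ((1 + s) * Real.log (1 + s)
      - (1 - s) * Real.log (1 - s)) / s) 1 :=
    ((Real.continuous_mul_log.comp (continuous_const.add continuous_id)).sub
      (Real.continuous_mul_log.comp (continuous_const.sub continuous_id))).continuousAt.div
      continuousAt_id one_ne_zero
  have hs : Tendsto (fun z : ℝ => √(1 - z ^ 2)) (𝓝[Ioo 0 1] 0) (𝓝 1) := by
    have : Continuous (fun z : ℝ => √(1 - z ^ 2)) := by fun_prop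
    simpa using (this.tendsto 0).mono_left nhdsWithin_le_nhds
  have hv : ((1 + 1) * Real.log (1 + 1) - (1 - 1) * Real.log (1 - 1)) / 1 = 2 * Real.log 2 := by
    norm_num
  rw [← hv]
  refine (hc.tendsto.comp hs).congr' ?_
  filter_upwards [self_mem_nhdsWithin] with z hz using (gfun_eq_mul_log hz).symm

lemma tendsto_ffun_zero : Tendsto ffun (𝓝[Ioo 0 1] 0) atTop := by
  have hl : Tendsto (fun z : ℝ => -(2 * Real.log z)) (𝓝[Ioo 0 1] 0) atTop :=
    tendsto_neg_atBot_atTop.comp ((Real.tendsto_log_nhdsGT_zero.mono_left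
      (nhdsWithin_mono 0 Ioo_subset_Ioi_self)).const_mul_atBot two_pos)
  refine (tendsto_gfun_zero.add_atTop hl).congr fun z => ?_
  simp [gfun]

lemma gfun_lt_two {z : ℝ} (hz : z ∈ Ioo (0 : ℝ) 1) : gfun z < 2 := by
  obtain ⟨w, hzw, hw1⟩ := exists_between hz.2
  have hw : w ∈ Ioo (0 : ℝ) 1 := ⟨hz.1.trans hzw, hw1⟩
  have : (𝓝[Ioo (0 : ℝ) 1] 1).NeBot := right_nhdsWithin_Ioo_neBot one_pos
  refine (strictMonoOn_gfun hz hw hzw).trans_le (ge_of_tendsto tendsto_gfun_one ?_)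
  filter_upwards [self_mem_nhdsWithin, mem_nhdsWithin_of_mem_nhds (Ioi_mem_nhds hw1)]
    with x hx hwx using (strictMonoOn_gfun hw hx hwx).le

lemma two_mul_log_two_lt_gfun {z : ℝ} (hz : z ∈ Ioo (0 : ℝ) 1) : 2 * Real.log 2 < gfun z := by
  obtain ⟨w, hw0, hwz⟩ := exists_between hz.1
  have hw : w ∈ Ioo (0 : ℝ) 1 := ⟨hw0, hwz.trans hz.2⟩
  have : (𝓝[Ioo (0 : ℝ) 1] 0).NeBot := left_nhdsWithin_Ioo_neBot one_pos
  refine (le_of_tendsto tendsto_gfun_zero ?_).trans_lt (strictMonoOn_gfun hw hz hwz)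
  filter_upwards [self_mem_nhdsWithin, mem_nhdsWithin_of_mem_nhds (Iio_mem_nhds hw0)]
    with x hx hwx using (strictMonoOn_gfun hx hw hwx).le

theorem statement9 :
    StrictAntiOn ffun (Set.Ioo 0 1) ∧ StrictMonoOn gfun (Set.Ioo 0 1)
    ∧ (∀ z ∈ Set.Ioo (0 : ℝ) 1, 2 < ffun z)
    ∧ (∀ z ∈ Set.Ioo (0 : ℝ) 1, 2 * Real.log 2 < gfun z ∧ gfun z < 2)
    ∧ Tendsto ffun (nhdsWithin 1 (Set.Ioo 0 1)) (nhds 2)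
    ∧ Tendsto gfun (nhdsWithin 1 (Set.Ioo 0 1)) (nhds 2)
    ∧ Tendsto ffun (nhdsWithin 0 (Set.Ioo 0 1)) atTop
    ∧ Tendsto gfun (nhdsWithin 0 (Set.Ioo 0 1)) (nhds (2 * Real.log 2)) :=
  ⟨strictAntiOn_ffun, strictMonoOn_gfun, fun _ => two_lt_ffun,
    fun _ hz => ⟨two_mul_log_two_lt_gfun hz, gfun_lt_two hz⟩,
    tendsto_ffun_one, tendsto_gfun_one, tendsto_ffun_zero, tendsto_gfun_zero⟩
end

section
/- Let τ₁, τ₂ > 0 and let a, b, c, d ≥ 0 satisfy a + b = 1 and c + d = 1. Set X := √(a·τ₁ + b·τ₂) and Y := √(c·τ₁ + d·τ₂). Then X·Y/(X² + Y²) ≥ √(τ₁·τ₂)/(τ₁ + τ₂). -/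
theorem statement15 (τ₁ τ₂ : ℝ) (hτ₁ : 0 < τ₁) (hτ₂ : 0 < τ₂)
    (a b c d : ℝ) (ha : 0 ≤ a) (hb : 0 ≤ b) (hc : 0 ≤ c) (hd : 0 ≤ d)
    (hab : a + b = 1) (hcd : c + d = 1)
    (X Y : ℝ) (hX : X = Real.sqrt (a * τ₁ + b * τ₂)) (hY : Y = Real.sqrt (c * τ₁ + d * τ₂)) :
    X * Y / (X ^ 2 + Y ^ 2) ≥ Real.sqrt (τ₁ * τ₂) / (τ₁ + τ₂) := by
  have convex_pos : ∀ u v : ℝ, 0 ≤ u → 0 ≤ v → u + v = 1 → 0 < u * τ₁ + v * τ₂ := by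
    intro u v hu hv huv
    rcases hu.eq_or_lt with rfl | hu
    · obtain rfl : v = 1 := by linarith
      simpa using hτ₂
    · positivity
  have hP := convex_pos a b ha hb hab
  have hQ := convex_pos c d hc hd hcd
  have hXsq : X ^ 2 = a * τ₁ + b * τ₂ := by rw [hX, Real.sq_sqrt hP.le]
  have hYsq : Y ^ 2 = c * τ₁ + d * τ₂ := by rw [hY, Real.sq_sqrt hQ.le]
  have hX0 : 0 ≤ X := hX ▸ Real.sqrt_nonneg _
  have hY0 : 0 ≤ Y := hY ▸ Real.sqrt_nonneg _
  rw [ge_iff_le, div_le_div_iff₀ (by positivity) (by rw [hXsq, hYsq]; positivity)]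
  refine le_of_pow_le_pow_left₀ two_ne_zero (by positivity) ?_
  rw [mul_pow, mul_pow, mul_pow, Real.sq_sqrt (by positivity), hXsq, hYsq]
  have key : 0 ≤ (τ₁ - τ₂) ^ 2 * ((a * τ₁ + d * τ₂) * (c * τ₁ + b * τ₂)) := by positivity
  obtain rfl : b = 1 - a := by linarith
  obtain rfl : d = 1 - c := by linarith
  linear_combination key
end

section
/- Let τ₁, τ₂ > 0, let η₁ ≥ η₂ > 0, and let a, b, c, d ≥ 0 satisfy a + b = 1 and c + d = 1. Set X := √(a·τ₁ + b·τ₂) and Y := √(c·τ₁ + d·τ₂). Then X·Y·(c·η₁ + d·η₂) / ((a·η₁ + b·η₂)·Y² + (c·η₁ + d·η₂)·X²) ≥ √(τ₁·τ₂)·η₂ / (τ₁·η₂ + τ₂·η₁). -/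
/-- The case `a = 1`, in terms of `m = √τ₁`, `n = √τ₂` and `w = √(c τ₁ + d τ₂)`. -/
lemma ratio_bound_left_endpoint {m n w e f c d : ℝ} (hm : 0 < m) (hn : 0 < n) (hw : 0 < w)
    (hef : f ≤ e) (hf : 0 < f) (hc : 0 ≤ c) (hd : 0 ≤ d) (hcd : c + d = 1)
    (hy : w ^ 2 = c * m ^ 2 + d * n ^ 2) :
    n * f * (e * w ^ 2 + (c * e + d * f) * m ^ 2)
      ≤ w * (c * e + d * f) * (m ^ 2 * f + n ^ 2 * e) := by
  have he : 0 < e := hf.trans_le hef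
  have hA : 0 ≤ e - f := sub_nonneg.2 hef
  have hquad : 0 ≤ ((m ^ 2 - n ^ 2) * f) ^ 2 - (m ^ 2 - n ^ 2) * f * ((e - f) * n ^ 2)
      + 2 * (e - f) * f * n ^ 4 + 2 * ((e - f) * n ^ 2) ^ 2 := by
    have h : 0 ≤ (e - f) * f * n ^ 4 := by positivity
    nlinarith [sq_nonneg ((m ^ 2 - n ^ 2) * f - (e - f) * n ^ 2 / 2),
      sq_nonneg ((e - f) * n ^ 2)]
  have hpoly : f * (e * w ^ 2 + (c * e + d * f) * m ^ 2) * (w ^ 2 + n ^ 2)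
      ≤ 2 * w ^ 2 * (c * e + d * f) * (m ^ 2 * f + n ^ 2 * e) := by
    have h₁ := mul_nonneg (mul_nonneg hc hd) hquad
    have h₂ : 0 ≤ c ^ 2 * (2 * e * (e - f) * m ^ 2 * n ^ 2) := by positivity
    obtain rfl : d = 1 - c := by linarith
    rw [hy]
    linear_combination h₁ + h₂
  have hmean : 2 * w * n ≤ w ^ 2 + n ^ 2 := two_mul_le_add_sq w n
  refine le_of_mul_le_mul_right ?_ (by positivity : 0 < w ^ 2 + n ^ 2)
  calc n * f * (e * w ^ 2 + (c * e + d * f) * m ^ 2) * (w ^ 2 + n ^ 2)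
      = n * (f * (e * w ^ 2 + (c * e + d * f) * m ^ 2) * (w ^ 2 + n ^ 2)) := by ring
    _ ≤ n * (2 * w ^ 2 * (c * e + d * f) * (m ^ 2 * f + n ^ 2 * e)) := by gcongr
    _ = w * (c * e + d * f) * (m ^ 2 * f + n ^ 2 * e) * (2 * w * n) := by ring
    _ ≤ _ := by gcongr

/-- The case `a = 0`, in terms of `m = √τ₁`, `n = √τ₂` and `w = √(c τ₁ + d τ₂)`. -/
lemma ratio_bound_right_endpoint {m n w e f c d : ℝ} (hm : 0 < m) (hn : 0 < n) (hw : 0 < w)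
    (hef : f ≤ e) (hf : 0 < f) (hc : 0 ≤ c) (hd : 0 ≤ d) (hcd : c + d = 1)
    (hy : w ^ 2 = c * m ^ 2 + d * n ^ 2) :
    m * f * (f * w ^ 2 + (c * e + d * f) * n ^ 2)
      ≤ w * (c * e + d * f) * (m ^ 2 * f + n ^ 2 * e) := by
  have hq : f ≤ c * e + d * f := by
    obtain rfl : d = 1 - c := by linarith
    nlinarith [mul_nonneg hc (sub_nonneg.2 hef)]
  have hq₀ : 0 < c * e + d * f := hf.trans_le hq
  have hmean : m * (w ^ 2 + n ^ 2) ≤ w * (m ^ 2 + n ^ 2) := by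
    obtain rfl : d = 1 - c := by linarith
    have hprod : 0 ≤ (m - w) * (m * w - n ^ 2) := by
      rcases le_total n m with h | h
      · have hsq : n ^ 2 ≤ m ^ 2 := by gcongr
        have h₁ : w ≤ m := le_of_pow_le_pow_left₀ two_ne_zero hm.le (by nlinarith)
        have h₂ : n ≤ w := le_of_pow_le_pow_left₀ two_ne_zero hw.le (by nlinarith)
        exact mul_nonneg (by linarith) (by nlinarith)
      · have hsq : m ^ 2 ≤ n ^ 2 := by gcongr
        have h₁ : m ≤ w := le_of_pow_le_pow_left₀ two_ne_zero hw.le (by nlinarith)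
        have h₂ : w ≤ n := le_of_pow_le_pow_left₀ two_ne_zero hn.le (by nlinarith)
        exact mul_nonneg_of_nonpos_of_nonpos (by linarith) (by nlinarith)
    linear_combination hprod
  calc m * f * (f * w ^ 2 + (c * e + d * f) * n ^ 2)
      ≤ m * f * ((c * e + d * f) * w ^ 2 + (c * e + d * f) * n ^ 2) := by gcongr
    _ = f * (c * e + d * f) * (m * (w ^ 2 + n ^ 2)) := by ring
    _ ≤ f * (c * e + d * f) * (w * (m ^ 2 + n ^ 2)) := by gcongr
    _ = w * (c * e + d * f) * (m ^ 2 * f + n ^ 2 * f) := by ring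
    _ ≤ _ := by gcongr

theorem statement16 (τ₁ τ₂ η₁ η₂ : ℝ) (hτ₁ : 0 < τ₁) (hτ₂ : 0 < τ₂)
    (hη : η₁ ≥ η₂) (hη₂ : 0 < η₂)
    (a b c d : ℝ) (ha : 0 ≤ a) (hb : 0 ≤ b) (hc : 0 ≤ c) (hd : 0 ≤ d)
    (hab : a + b = 1) (hcd : c + d = 1)
    (X Y : ℝ) (hX : X = Real.sqrt (a * τ₁ + b * τ₂)) (hY : Y = Real.sqrt (c * τ₁ + d * τ₂)) :
    X * Y * (c * η₁ + d * η₂) / ((a * η₁ + b * η₂) * Y ^ 2 + (c * η₁ + d * η₂) * X ^ 2)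
      ≥ Real.sqrt (τ₁ * τ₂) * η₂ / (τ₁ * η₂ + τ₂ * η₁) := by
  have hη₁ : 0 < η₁ := hη₂.trans_le hη
  have pos_comb {s t x y : ℝ} (hs : 0 ≤ s) (ht : 0 ≤ t) (hst : s + t = 1) (hx : 0 < x)
      (hy : 0 < y) : 0 < s * x + t * y := convex_Ioi (0 : ℝ) hx hy hs ht hst
  have hx := pos_comb ha hb hab hτ₁ hτ₂
  have hy := pos_comb hc hd hcd hτ₁ hτ₂
  have hp := pos_comb ha hb hab hη₁ hη₂
  have hq := pos_comb hc hd hcd hη₁ hη₂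
  have hX₀ : 0 < X := hX ▸ Real.sqrt_pos.2 hx
  have hY₀ : 0 < Y := hY ▸ Real.sqrt_pos.2 hy
  have hX₂ : X ^ 2 = a * τ₁ + b * τ₂ := hX ▸ Real.sq_sqrt hx.le
  have hY₂ : Y ^ 2 = c * τ₁ + d * τ₂ := hY ▸ Real.sq_sqrt hy.le
  have hconc : a * √τ₁ + b * √τ₂ ≤ X :=
    hX ▸ Real.strictConcaveOn_sqrt.concaveOn.2 hτ₁.le hτ₂.le ha hb hab
  have hm := Real.sqrt_pos.2 hτ₁
  have hn := Real.sqrt_pos.2 hτ₂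
  have hm₂ := Real.sq_sqrt hτ₁.le
  have hn₂ := Real.sq_sqrt hτ₂.le
  rw [Real.sqrt_mul hτ₁.le]
  generalize √τ₁ = m at *
  generalize √τ₂ = n at *
  subst hm₂ hn₂
  have h₁ := ratio_bound_left_endpoint hm hn hY₀ hη hη₂ hc hd hcd hY₂
  have h₂ := ratio_bound_right_endpoint hm hn hY₀ hη hη₂ hc hd hcd hY₂
  rw [ge_iff_le, div_le_div_iff₀ (by positivity) (by positivity)]
  calc m * n * η₂ * ((a * η₁ + b * η₂) * Y ^ 2 + (c * η₁ + d * η₂) * X ^ 2)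
      = a * m * (n * η₂ * (η₁ * Y ^ 2 + (c * η₁ + d * η₂) * m ^ 2))
        + b * n * (m * η₂ * (η₂ * Y ^ 2 + (c * η₁ + d * η₂) * n ^ 2)) := by
          rw [hX₂]; ring
    _ ≤ a * m * (Y * (c * η₁ + d * η₂) * (m ^ 2 * η₂ + n ^ 2 * η₁))
        + b * n * (Y * (c * η₁ + d * η₂) * (m ^ 2 * η₂ + n ^ 2 * η₁)) := by gcongr
    _ = (a * m + b * n) * (Y * (c * η₁ + d * η₂) * (m ^ 2 * η₂ + n ^ 2 * η₁)) := by ring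
    _ ≤ X * (Y * (c * η₁ + d * η₂) * (m ^ 2 * η₂ + n ^ 2 * η₁)) := by gcongr
    _ = X * Y * (c * η₁ + d * η₂) * (m ^ 2 * η₂ + n ^ 2 * η₁) := by ring
end

section
/- The function h, defined by h(x) := exp(1/x) · ∫_{1/x}^∞ e^{−t}/t dt for x > 0, is strictly monotonically increasing on (0, ∞). -/
open MeasureTheory Set

theorem exp_mul_integral_Ioi_exp_neg_div (y : ℝ) :
    Real.exp y * ∫ t in Ioi y, Real.exp (-t) / t = ∫ s in Ioi (0 : ℝ), Real.exp (-s) / (s + y) := by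
  have hshift := (measurePreserving_add_right (volume : Measure ℝ) y).setIntegral_preimage_emb
    (measurableEmbedding_addRight y) (fun t => Real.exp (-t) / t) (Ioi y)
  rw [← hshift, ← integral_const_mul]
  simp only [preimage_add_const_Ioi, sub_self]
  congr 1 with s
  rw [← mul_div_assoc, ← Real.exp_add]
  ring_nf

theorem integrableOn_Ioi_exp_neg_div_add {y : ℝ} (hy : 0 < y) :
    IntegrableOn (fun s => Real.exp (-s) / (s + y)) (Ioi 0) := by
  refine ((integrableOn_exp_neg_Ioi 0).div_const y).mono'
    (Measurable.aestronglyMeasurable (by fun_prop)) ?_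
  filter_upwards [ae_restrict_mem measurableSet_Ioi] with s hs
  have hs : 0 < s := hs
  rw [Real.norm_of_nonneg (by positivity)]
  gcongr
  linarith

theorem integral_Ioi_exp_neg_div_add_strictAntiOn :
    StrictAntiOn (fun y : ℝ => ∫ s in Ioi (0 : ℝ), Real.exp (-s) / (s + y)) (Ioi 0) := by
  intro a (ha : 0 < a) b (hb : 0 < b) hab
  have hia := integrableOn_Ioi_exp_neg_div_add ha
  have hib := integrableOn_Ioi_exp_neg_div_add hb
  have hpos : ∀ s ∈ Ioi (0 : ℝ), 0 < Real.exp (-s) / (s + a) - Real.exp (-s) / (s + b) := by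
    intro s (hs : 0 < s)
    rw [sub_pos]
    gcongr
  have hint : 0 < ∫ s in Ioi (0 : ℝ), (Real.exp (-s) / (s + a) - Real.exp (-s) / (s + b)) := by
    rw [setIntegral_pos_iff_support_of_nonneg_ae
      ((ae_restrict_mem measurableSet_Ioi).mono fun s hs => (hpos s hs).le) (hia.sub hib),
      inter_eq_right.mpr fun s hs => Function.mem_support.mpr (hpos s hs).ne']
    simp
  rw [integral_sub hia hib] at hint
  exact sub_pos.mp hint

theorem statement19 : StrictMonoOn hfun (Set.Ioi (0 : ℝ)) := by
  intro x (hx : 0 < x) z (hz : 0 < z) hxz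
  simp only [hfun, exp_mul_integral_Ioi_exp_neg_div]
  exact integral_Ioi_exp_neg_div_add_strictAntiOn (one_div_pos.mpr hz) (one_div_pos.mpr hx)
    (one_div_lt_one_div_of_lt hx hxz)
end
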